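/- Let (X,Y) be jointly distributed random variables, each taking values in a finite set Σ with |Σ| ≥ 2, and let N > 1 be an integer. Then for every δ ∈ (0,1), with probability at least 1−δ over N i.i.d. samples of (X,Y), the empirical mutual information satisfies Î(X;Y) ≥ (1/50)·I(X;Y) − 1800·|Σ|²·(log N / N)·log(6·|Σ|²/δ). -/

import Mathlib

open scoped BigOperators

noncomputable section

open Classical in
/-- Probability that `N` i.i.d. samples from the pmf `p` satisfy the event `E`. -/
noncomputable def iidProb {α : Type*} [Fintype α] (p : α → ℝ) (N : ℕ)
    (E : (Fin N → α) → Prop) : ℝ :=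
  ∑ s : Fin N → α, if E s then ∏ i, p (s i) else 0

open Classical in
/-- Empirical frequency (relative frequency) of the outcome `a` among the samples `s`. -/
noncomputable def empFreq {α : Type*} [Fintype α] {N : ℕ} (s : Fin N → α) (a : α) : ℝ :=
  ((Finset.univ.filter fun i => s i = a).card : ℝ) / N

/-- Marginal of the first coordinate of a joint pmf. -/
noncomputable def margFst {α β : Type*} [Fintype β] (p : α × β → ℝ) (x : α) : ℝ :=
  ∑ y, p (x, y)

/-- Marginal of the second coordinate of a joint pmf. -/
noncomputable def margSnd {α β : Type*} [Fintype α] (p : α × β → ℝ) (y : β) : ℝ :=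
  ∑ x, p (x, y)

/-- Mutual information `I(X;Y)` of a joint pmf on `α × β` (natural logarithm;
summands with zero probability vanish since `Real.log 0 = 0` and `x / 0 = 0`). -/
noncomputable def mutInfo {α β : Type*} [Fintype α] [Fintype β] (p : α × β → ℝ) : ℝ :=
  ∑ x, ∑ y, p (x, y) * Real.log (p (x, y) / (margFst p x * margSnd p y))

/-- Conditional mutual information `I(X;Y∣Z)` of a joint pmf on `α × β × γ`. -/
noncomputable def condMutInfo {α β γ : Type*} [Fintype α] [Fintype β] [Fintype γ]
    (p : α × β × γ → ℝ) : ℝ :=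
  ∑ x, ∑ y, ∑ z, p (x, y, z) *
    Real.log (p (x, y, z) * (∑ x', ∑ y', p (x', y', z)) /
      ((∑ y', p (x, y', z)) * (∑ x', p (x', y, z))))

/-- The pointwise relative entropy `u log (u / v) - u + v`. -/
def relEntropyTerm (u v : ℝ) : ℝ := u * Real.log (u / v) - u + v

lemma sq_sqrt_sub_le_relEntropyTerm {u v : ℝ} (hu : 0 ≤ u) (hv : 0 ≤ v) (huv : v = 0 → u = 0) :
    (√u - √v) ^ 2 ≤ relEntropyTerm u v := by
  unfold relEntropyTerm
  rcases hu.eq_or_lt with rfl | hu0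
  · simp [Real.sq_sqrt hv]
  have hv0 : 0 < v := hv.lt_of_ne fun h => hu0.ne' (huv h.symm)
  have hsu := Real.sqrt_pos.2 hu0
  have hsv := Real.sqrt_pos.2 hv0
  have h1 := Real.one_sub_inv_le_log_of_pos (div_pos hsu hsv)
  have h2 : Real.log (u / v) = 2 * Real.log (√u / √v) := by
    rw [← Real.sqrt_div hu, Real.log_sqrt (by positivity)]; ring
  have h3 : u * (√u / √v)⁻¹ = √u * √v := by
    rw [inv_div]; nth_rewrite 1 [← Real.mul_self_sqrt hu]; field_simp
  have h4 := mul_le_mul_of_nonneg_left h1 hu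
  rw [h2]
  nlinarith [Real.sq_sqrt hu, Real.sq_sqrt hv]

lemma relEntropyTerm_nonneg {u v : ℝ} (hu : 0 ≤ u) (hv : 0 ≤ v) (huv : v = 0 → u = 0) :
    0 ≤ relEntropyTerm u v :=
  (sq_nonneg _).trans (sq_sqrt_sub_le_relEntropyTerm hu hv huv)

lemma relEntropyTerm_le_of_le_nine_mul {u v : ℝ} (hu : 0 ≤ u) (hv : 0 ≤ v) (h : u ≤ 9 * v) :
    relEntropyTerm u v ≤ 16 * (√u - √v) ^ 2 := by
  rcases hv.eq_or_lt with rfl | hv0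
  · have : u = 0 := by linarith
    simp [relEntropyTerm, this]
  have h1 : relEntropyTerm u v ≤ (u - v) ^ 2 / v := by
    rcases hu.eq_or_lt with rfl | hu0
    · simp [relEntropyTerm]; field_simp; rfl
    have := mul_le_mul_of_nonneg_left (Real.log_le_sub_one_of_pos (div_pos hu0 hv0)) hu
    have e : (u - v) ^ 2 / v = u * (u / v - 1) - u + v := by field_simp; ring
    rw [e]; unfold relEntropyTerm; linarith
  refine h1.trans ?_
  rw [div_le_iff₀ hv0]
  have hsv := Real.sqrt_nonneg v
  have hsu := Real.sqrt_nonneg u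
  have h9 : √u ≤ 3 * √v := by
    apply Real.sqrt_le_iff.2 ⟨by positivity, ?_⟩
    rw [mul_pow, Real.sq_sqrt hv]; linarith
  have h16 : (√u + √v) ^ 2 ≤ 16 * v := by
    nlinarith [Real.sq_sqrt hv]
  have e : (u - v) ^ 2 = (√u - √v) ^ 2 * (√u + √v) ^ 2 := by
    rw [← mul_pow, mul_comm, ← sq_sub_sq, Real.sq_sqrt hu, Real.sq_sqrt hv]
  rw [e]
  nlinarith [mul_le_mul_of_nonneg_left h16 (sq_nonneg (√u - √v))]

lemma mul_log_le_relEntropyTerm_of_close {p a b p' a' b' t : ℝ}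
    (hp0 : 0 < p) (hpa : p ≤ a) (hpb : p ≤ b) (hp' : 0 ≤ p') (hpa' : p' ≤ a') (hpb' : p' ≤ b')
    (dp : -t ≤ √p' - √p) (da : √a' - √a ≤ t) (db : √b' - √b ≤ t)
    (hc : 9 * (a * b) ≤ p) (hs : 10000 * t ^ 2 ≤ p) :
    p * Real.log (p / (a * b)) ≤ 50 * relEntropyTerm p' (a' * b') := by
  have hp := hp0.le
  have ha0' := hp'.trans hpa'
  have hb0' := hp'.trans hpb'
  have hap : 0 < a := hp0.trans_le hpa
  have hbp : 0 < b := hp0.trans_le hpb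
  have hq : 0 < a * b := mul_pos hap hbp
  have hst : 100 * t ≤ √p := by
    apply Real.le_sqrt_of_sq_le
    rw [mul_pow]; linarith
  have hpl : 0.98 * p ≤ p' := by
    have h1 : 0.99 * √p ≤ √p' := by linarith
    have h2 := mul_self_le_mul_self (by positivity) h1
    rw [Real.mul_self_sqrt hp', mul_mul_mul_comm, Real.mul_self_sqrt hp] at h2
    linarith
  have up : ∀ c c' : ℝ, p ≤ c → 0 ≤ c' → √c' - √c ≤ t → c' ≤ 1.0201 * c := by
    intro c c' h h' hd
    have h1 := Real.sqrt_le_sqrt h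
    have h2 : √c' ≤ 1.01 * √c := by linarith
    have h3 := mul_self_le_mul_self (Real.sqrt_nonneg _) h2
    rw [Real.mul_self_sqrt h', mul_mul_mul_comm, Real.mul_self_sqrt (hp.trans h)] at h3
    linarith
  have hau := up a a' hpa ha0' da
  have hbu := up b b' hpb hb0' db
  have hqu : a' * b' ≤ 1.041 * (a * b) := by
    have := mul_le_mul hau hbu hb0' (by positivity)
    nlinarith
  have hpp' : 0 < p' := by linarith
  have hqp' : 0 < a' * b' := mul_pos (by linarith) (by linarith)
  have hlr : Real.log 0.94 + Real.log (p / (a * b)) ≤ Real.log (p' / (a' * b')) := by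
    rw [← Real.log_mul (by norm_num) (by positivity)]
    apply Real.log_le_log (by positivity)
    rw [mul_div_assoc', div_le_div_iff₀ hq hqp']
    nlinarith [mul_le_mul hqu hpl (by positivity) (by positivity), mul_pos hp0 hq]
  have h94 : -0.07 ≤ Real.log 0.94 := by
    have := Real.one_sub_inv_le_log_of_pos (show (0 : ℝ) < 0.94 by norm_num)
    norm_num at this ⊢; linarith
  have h9 : 2 ≤ Real.log (p / (a * b)) := by
    rw [Real.le_log_iff_exp_le (by positivity)]
    have h1 : (9 : ℝ) ≤ p / (a * b) := by rw [le_div_iff₀ hq]; linarith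
    have h2 : Real.exp 2 = Real.exp 1 ^ 2 := by rw [← Real.exp_nat_mul]; norm_num
    rw [h2]
    nlinarith [Real.exp_one_lt_d9, Real.exp_pos 1]
  have h1 : p' * (Real.log (p / (a * b)) - 1.07) ≤ relEntropyTerm p' (a' * b') := by
    unfold relEntropyTerm
    have := mul_le_mul_of_nonneg_left hlr hp'
    nlinarith
  have h2 : 0.98 * p * (Real.log (p / (a * b)) - 1.07) ≤
      p' * (Real.log (p / (a * b)) - 1.07) :=
    mul_le_mul_of_nonneg_right hpl (by linarith)
  nlinarith [mul_le_mul_of_nonneg_left h9 hp]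

lemma mul_log_le_of_le {p a b t n : ℝ} (hp0 : 0 < p) (hpa : p ≤ a) (hpb : p ≤ b)
    (hn : 0 < n) (hnt : 1 ≤ n * t ^ 2) (hlog : 0 ≤ Real.log n) (hs : p ≤ 10000 * t ^ 2) :
    p * Real.log (p / (a * b)) ≤ t ^ 2 + 10000 * (t ^ 2 * Real.log n) := by
  have hp := hp0.le
  have hap : 0 < a := hp0.trans_le hpa
  have hbp : 0 < b := hp0.trans_le hpb
  have hq : 0 < a * b := mul_pos hap hbp
  have h1 : Real.log (p / (a * b)) ≤ Real.log (1 / (n * p)) + Real.log n := by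
    rw [← Real.log_mul (by positivity) (by positivity)]
    apply Real.log_le_log (by positivity)
    have e : 1 / (n * p) * n = 1 / p := by field_simp
    rw [e, div_le_div_iff₀ hq hp0]
    nlinarith
  have h2 := Real.log_le_sub_one_of_pos (show 0 < 1 / (n * p) by positivity)
  have h3 : p * (1 / (n * p)) ≤ t ^ 2 := by
    have e : p * (1 / (n * p)) = 1 / n := by field_simp
    rw [e, div_le_iff₀ hn]; linarith
  have h4 : p * Real.log n ≤ 10000 * t ^ 2 * Real.log n :=
    mul_le_mul_of_nonneg_right hs (by linarith)
  have h5 : p * Real.log (p / (a * b)) ≤ p * (1 / (n * p) - 1 + Real.log n) :=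
    mul_le_mul_of_nonneg_left (by linarith) hp
  linarith [h5, show p * (1 / (n * p) - 1 + Real.log n) =
    p * (1 / (n * p)) - p + p * Real.log n by ring]

lemma relEntropyTerm_le_relEntropyTerm_of_close {p a b p' a' b' t n : ℝ}
    (hp : 0 ≤ p) (hpa : p ≤ a) (ha : a ≤ 1) (hpb : p ≤ b) (hb : b ≤ 1)
    (hp' : 0 ≤ p') (hpa' : p' ≤ a') (ha' : a' ≤ 1) (hpb' : p' ≤ b')
    (ht : 0 ≤ t) (dp : |√p' - √p| ≤ t) (da : |√a' - √a| ≤ t) (db : |√b' - √b| ≤ t)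
    (hn : 0 < n) (hnt : 1 ≤ n * t ^ 2) (hlog : 1 / 2 ≤ Real.log n) :
    relEntropyTerm p (a * b) ≤
      50 * relEntropyTerm p' (a' * b') + 90000 * (t ^ 2 * Real.log n) := by
  have ha0 := hp.trans hpa
  have hb0 := hp.trans hpb
  have ha0' := hp'.trans hpa'
  have hb0' := hp'.trans hpb'
  have hq0' : a' * b' = 0 → p' = 0 := fun h => by
    rcases mul_eq_zero.1 h with h | h <;> linarith
  have hq' : 0 ≤ a' * b' := by positivity
  have hH := sq_sqrt_sub_le_relEntropyTerm hp' hq' hq0'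
  have hD' := relEntropyTerm_nonneg hp' hq' hq0'
  have htlog : t ^ 2 ≤ 2 * (t ^ 2 * Real.log n) := by nlinarith [sq_nonneg t]
  rw [abs_le] at dp da db
  rcases le_total p (9 * (a * b)) with hc | hc
  · have h1 := relEntropyTerm_le_of_le_nine_mul hp (mul_nonneg ha0 hb0) hc
    have hsa := Real.sqrt_le_one.2 ha
    have hsb := Real.sqrt_le_one.2 hb
    have hsa' := Real.sqrt_le_one.2 ha'
    have hq : |√(a' * b') - √(a * b)| ≤ 2 * t := by
      rw [Real.sqrt_mul ha0, Real.sqrt_mul ha0', abs_le]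
      have e : √a' * √b' - √a * √b = √a' * (√b' - √b) + (√a' - √a) * √b := by ring
      rw [e]
      constructor <;> nlinarith [Real.sqrt_nonneg a', Real.sqrt_nonneg b]
    rw [abs_le] at hq
    have h2 : (√p - √(a * b)) ^ 2 ≤ 2 * (√p' - √(a' * b')) ^ 2 + 18 * t ^ 2 := by
      have h3 : ((√p - √(a * b)) - (√p' - √(a' * b'))) ^ 2 ≤ (3 * t) ^ 2 :=
        sq_le_sq' (by linarith) (by linarith)
      nlinarith [sq_nonneg ((√p - √(a * b)) - 2 * (√p' - √(a' * b')))]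
    nlinarith
  rcases hp.eq_or_lt with rfl | hp0
  · have : a * b = 0 := le_antisymm (by linarith) (by positivity)
    rw [this]
    have : 0 ≤ t ^ 2 * Real.log n := by positivity
    have h0 : relEntropyTerm 0 0 = 0 := by simp [relEntropyTerm]
    rw [h0]; linarith
  have hap : 0 < a := by linarith
  have hbp : 0 < b := by linarith
  have hq : 0 < a * b := by positivity
  have hle : relEntropyTerm p (a * b) ≤ p * Real.log (p / (a * b)) := by
    unfold relEntropyTerm; linarith
  refine hle.trans ?_
  rcases le_total p (10000 * t ^ 2) with hs | hs
  · have h3 := mul_log_le_of_le hp0 hpa hpb hn hnt (by linarith) hs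
    linarith
  · have h3 : 0 ≤ t ^ 2 * Real.log n := by positivity
    have h4 := mul_log_le_relEntropyTerm_of_close hp0 hpa hpb hp' hpa' hpb' dp.1 da.2 db.2 hc hs
    linarith

lemma mutInfo_eq_sum_relEntropyTerm {α β : Type*} [Fintype α] [Fintype β] (p : α × β → ℝ)
    (hsum : ∑ w, p w = 1) :
    mutInfo p = ∑ x, ∑ y, relEntropyTerm (p (x, y)) (margFst p x * margSnd p y) := by
  have h1 : ∑ x, ∑ y, p (x, y) = 1 := by rw [← Fintype.sum_prod_type, hsum]
  have h2 : ∑ x, margFst p x = 1 := h1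
  have h3 : ∑ y, margSnd p y = 1 := by
    rw [← h1, Finset.sum_comm]; rfl
  have h4 : ∑ x, ∑ y, margFst p x * margSnd p y = 1 := by
    rw [← Finset.sum_mul_sum, h2, h3, one_mul]
  simp only [relEntropyTerm, Finset.sum_add_distrib, Finset.sum_sub_distrib, h1, h4, mutInfo]
  ring

open Classical in
/-- The mass that `p` gives to the predicate `A`. -/
def eventMass {α : Type*} [Fintype α] (p : α → ℝ) (A : α → Prop) : ℝ :=
  ∑ a, if A a then p a else 0

lemma eventMass_nonneg {α : Type*} [Fintype α] {p : α → ℝ} (hp : ∀ a, 0 ≤ p a)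
    (A : α → Prop) : 0 ≤ eventMass p A :=
  Finset.sum_nonneg fun a _ => by split_ifs <;> simp [hp]

open Classical in
lemma eventMass_empFreq {α : Type*} [Fintype α] {N : ℕ} (s : Fin N → α) (A : α → Prop) :
    eventMass (empFreq s) A = ((Finset.univ.filter fun i => A (s i)).card : ℝ) / N := by
  unfold eventMass empFreq
  rw [← Finset.sum_filter, ← Finset.sum_div,
    Finset.card_eq_sum_card_fiberwise (f := s) (t := Finset.univ.filter A)
      (fun i hi => by simpa using hi)]
  push_cast
  congr 1
  refine Finset.sum_congr rfl fun a ha => ?_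
  congr 2
  ext i
  simp only [Finset.mem_filter, Finset.mem_univ, true_and] at ha ⊢
  exact ⟨fun h => ⟨h ▸ ha, h⟩, fun h => h.2⟩

lemma eventMass_eq {α : Type*} [Fintype α] (p : α → ℝ) (a : α) :
    eventMass p (fun w => w = a) = p a := by
  classical
  simp [eventMass]

lemma eventMass_fst {α β : Type*} [Fintype α] [Fintype β] (p : α × β → ℝ) (x : α) :
    eventMass p (fun w => w.1 = x) = margFst p x := by
  classical
  simp only [eventMass, margFst, Fintype.sum_prod_type]
  rw [Finset.sum_eq_single x] <;> simp +contextual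

lemma eventMass_snd {α β : Type*} [Fintype α] [Fintype β] (p : α × β → ℝ) (y : β) :
    eventMass p (fun w => w.2 = y) = margSnd p y := by
  classical
  simp only [eventMass, margSnd, Fintype.sum_prod_type_right]
  rw [Finset.sum_eq_single y] <;> simp +contextual

lemma empFreq_nonneg {α : Type*} [Fintype α] {N : ℕ} (s : Fin N → α) (a : α) :
    0 ≤ empFreq s a :=
  div_nonneg (Nat.cast_nonneg _) (Nat.cast_nonneg _)

lemma sum_empFreq {α : Type*} [Fintype α] {N : ℕ} (hN : N ≠ 0) (s : Fin N → α) :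
    ∑ a, empFreq s a = 1 := by
  have h := eventMass_empFreq s fun _ => True
  simpa [eventMass, hN] using h

open Classical in
lemma sum_prod_mul_pow_card_le_exp {α : Type*} [Fintype α] {p : α → ℝ} (hp : ∀ a, 0 ≤ p a)
    (hsum : ∑ a, p a = 1) (N : ℕ) (A : α → Prop) {z : ℝ} (hz : 0 ≤ z) :
    ∑ s : Fin N → α, (∏ i, p (s i)) * z ^ (Finset.univ.filter fun i => A (s i)).card ≤
      Real.exp (N * (eventMass p A * (z - 1))) := by
  have h1 : ∀ s : Fin N → α, (∏ i, p (s i)) * z ^ (Finset.univ.filter fun i => A (s i)).card =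
      ∏ i, (p (s i) * if A (s i) then z else 1) := fun s => by
    rw [Finset.prod_mul_distrib, Finset.prod_ite]; simp
  have h2 : ∑ a, (p a * if A a then z else 1) = eventMass p A * (z - 1) + 1 := by
    nth_rewrite 3 [← hsum]
    rw [eventMass, Finset.sum_mul, ← Finset.sum_add_distrib]
    refine Finset.sum_congr rfl fun a _ => ?_
    split_ifs <;> ring
  simp only [h1]
  rw [← Fintype.sum_pow (fun a => p a * if A a then z else 1), h2, Real.exp_nat_mul]
  refine pow_le_pow_left₀ ?_ (Real.add_one_le_exp _) N
  rw [← h2]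
  exact Finset.sum_nonneg fun a _ => mul_nonneg (hp a) (by split_ifs <;> simp [hz])

lemma iidProb_le_of_card_mul_log {α : Type*} [Fintype α] {p : α → ℝ} (hp : ∀ a, 0 ≤ p a)
    (hsum : ∑ a, p a = 1) {N : ℕ} (hN : N ≠ 0) (A : α → Prop) (E : (Fin N → α) → Prop)
    {z c : ℝ} (hz : 0 < z)
    (h : ∀ s, E s → eventMass p A * (z - 1) + c ≤ eventMass (empFreq s) A * Real.log z) :
    iidProb p N E ≤ Real.exp (-(N * c)) := by
  classical
  have hM := sum_prod_mul_pow_card_le_exp hp hsum N A hz.le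
  have h0 : ∀ s : Fin N → α, 0 ≤ ∏ i, p (s i) := fun s => Finset.prod_nonneg fun i _ => hp _
  have key : iidProb p N E * Real.exp (N * (eventMass p A * (z - 1) + c)) ≤
      Real.exp (N * (eventMass p A * (z - 1))) := by
    refine le_trans ?_ hM
    unfold iidProb
    rw [Finset.sum_mul]
    refine Finset.sum_le_sum fun s _ => ?_
    split_ifs with hE
    · refine mul_le_mul_of_nonneg_left ?_ (h0 s)
      have h1 := h s hE
      rw [eventMass_empFreq] at h1
      rw [← Real.exp_log (pow_pos hz _), Real.log_pow]
      apply Real.exp_le_exp.2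
      have hN0 : (0 : ℝ) < N := by positivity
      refine (mul_le_mul_of_nonneg_left h1 hN0.le).trans (le_of_eq ?_)
      field_simp
    · rw [zero_mul]; exact mul_nonneg (h0 s) (by positivity)
  rw [mul_add, Real.exp_add, ← mul_assoc, mul_right_comm] at key
  have h2 := le_of_mul_le_mul_right (key.trans_eq (one_mul _).symm) (Real.exp_pos _)
  rwa [Real.exp_neg, ← one_div, le_div_iff₀ (Real.exp_pos _)]

lemma iidProb_sqrt_add_lt {α : Type*} [Fintype α] {p : α → ℝ} (hp : ∀ a, 0 ≤ p a)
    (hsum : ∑ a, p a = 1) {N : ℕ} (hN : N ≠ 0) (A : α → Prop) {t : ℝ} (ht : 0 ≤ t) :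
    iidProb p N (fun s => √(eventMass p A) + t < √(eventMass (empFreq s) A)) ≤
      Real.exp (-(N * t ^ 2)) := by
  have hm := eventMass_nonneg hp A
  rcases hm.eq_or_lt with h0 | h0
  · refine iidProb_le_of_card_mul_log hp hsum hN A _ (Real.exp_pos 1) fun s hs => ?_
    rw [← h0, Real.sqrt_zero, zero_add] at hs
    rw [← h0, Real.log_exp]
    have := (Real.lt_sqrt ht).1 hs
    linarith
  · have hs0 := Real.sqrt_pos.2 h0
    set u := √(eventMass p A) with hu
    have hm2 : eventMass p A = u ^ 2 := (Real.sq_sqrt hm).symm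
    refine iidProb_le_of_card_mul_log hp hsum hN A _ (z := (u + t) / u) (by positivity)
      fun s hs => ?_
    have h1 := Real.one_sub_inv_le_log_of_pos (show 0 < (u + t) / u by positivity)
    have h2 := (Real.lt_sqrt (by positivity)).1 hs
    have h3 : 1 - ((u + t) / u)⁻¹ = t / (u + t) := by field_simp; ring
    have h4 : 0 ≤ t / (u + t) := by positivity
    rw [h3] at h1
    have h5 := mul_le_mul h2.le h1 h4 ((sq_nonneg _).trans h2.le)
    refine le_trans (le_of_eq ?_) h5
    rw [hm2]; field_simp; ring

lemma iidProb_lt_sqrt_sub {α : Type*} [Fintype α] {p : α → ℝ} (hp : ∀ a, 0 ≤ p a)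
    (hsum : ∑ a, p a = 1) {N : ℕ} (hN : N ≠ 0) (A : α → Prop) {t : ℝ} (ht : 0 ≤ t) :
    iidProb p N (fun s => √(eventMass (empFreq s) A) < √(eventMass p A) - t) ≤
      Real.exp (-(N * t ^ 2)) := by
  have hm := eventMass_nonneg hp A
  set u := √(eventMass p A) with hu
  have hm2 : eventMass p A = u ^ 2 := (Real.sq_sqrt hm).symm
  rcases le_or_gt u t with hut | hut
  · refine iidProb_le_of_card_mul_log hp hsum hN A _ one_pos fun s hs => ?_
    linarith [Real.sqrt_nonneg (eventMass (empFreq s) A)]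
  · have hu0 : 0 < u := ht.trans_lt hut
    have hut' : 0 < u - t := sub_pos.2 hut
    refine iidProb_le_of_card_mul_log hp hsum hN A _ (z := (u - t) / u) (by positivity)
      fun s hs => ?_
    have h1 := Real.one_sub_inv_le_log_of_pos (show 0 < (u - t) / u by positivity)
    have h2 := (Real.sqrt_lt' hut').1 hs
    have h3 : 1 - ((u - t) / u)⁻¹ = -(t / (u - t)) := by
      rw [inv_div, one_sub_div hut'.ne', ← neg_div]; congr 1; ring
    have hF : 0 ≤ eventMass (empFreq s) A :=
      eventMass_nonneg (empFreq_nonneg s) A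
    have h4 : 0 ≤ t / (u - t) := by positivity
    rw [h3] at h1
    have h5 := mul_le_mul_of_nonneg_left h1 hF
    have h6 := mul_le_mul_of_nonneg_right h2.le h4
    have h7 : u ^ 2 * ((u - t) / u - 1) + t ^ 2 = -((u - t) ^ 2 * (t / (u - t))) := by
      have h8 : u * ((u - t) / u) = u - t := mul_div_cancel₀ _ hu0.ne'
      have h9 : (u - t) * (t / (u - t)) = t := mul_div_cancel₀ _ hut'.ne'
      linear_combination u * h8 + (u - t) * h9
    rw [hm2, h7]
    linarith

lemma one_sub_sum_le_iidProb {α ι : Type*} [Fintype α] [Fintype ι] {p : α → ℝ}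
    (hp : ∀ a, 0 ≤ p a) (hsum : ∑ a, p a = 1) (N : ℕ) (E : (Fin N → α) → Prop)
    (B : ι → (Fin N → α) → Prop) (h : ∀ s, (∀ j, ¬ B j s) → E s) :
    1 - ∑ j, iidProb p N (B j) ≤ iidProb p N E := by
  classical
  have h0 : ∀ s : Fin N → α, 0 ≤ ∏ i, p (s i) := fun s => Finset.prod_nonneg fun i _ => hp _
  have h1 : ∑ s : Fin N → α, ∏ i, p (s i) = 1 := by
    rw [← Fintype.sum_pow, hsum, one_pow]
  rw [sub_le_iff_le_add, ← h1]
  unfold iidProb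
  rw [Finset.sum_comm, ← Finset.sum_add_distrib]
  refine Finset.sum_le_sum fun s _ => ?_
  have hnn : ∀ j ∈ Finset.univ, 0 ≤ if B j s then ∏ i, p (s i) else 0 :=
    fun j _ => by split_ifs <;> simp [h0]
  by_cases hE : E s
  · rw [if_pos hE]
    linarith [Finset.sum_nonneg hnn]
  · obtain ⟨j, hj⟩ : ∃ j, B j s := by
      by_contra! hc
      exact hE (h s hc)
    have := Finset.single_le_sum hnn (Finset.mem_univ j)
    rw [if_pos hj] at this
    rw [if_neg hE, zero_add]
    exact this

lemma iidProb_forall_sqrt_close {α ι : Type*} [Fintype α] [Fintype ι] {p : α → ℝ}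
    (hp : ∀ a, 0 ≤ p a) (hsum : ∑ a, p a = 1) {N : ℕ} (hN : N ≠ 0) (A : ι → α → Prop)
    {t : ℝ} (ht : 0 ≤ t) (E : (Fin N → α) → Prop)
    (h : ∀ s, (∀ j, |√(eventMass (empFreq s) (A j)) - √(eventMass p (A j))| ≤ t) → E s) :
    1 - 2 * Fintype.card ι * Real.exp (-(N * t ^ 2)) ≤ iidProb p N E := by
  refine le_trans ?_ (one_sub_sum_le_iidProb (ι := ι ⊕ ι) hp hsum N E
    (Sum.elim
      (fun j s => √(eventMass p (A j)) + t < √(eventMass (empFreq s) (A j)))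
      (fun j s => √(eventMass (empFreq s) (A j)) < √(eventMass p (A j)) - t)) ?_)
  · rw [Fintype.sum_sum_type]
    have h1 := Finset.sum_le_card_nsmul (Finset.univ : Finset ι) _ _
      fun j _ => iidProb_sqrt_add_lt hp hsum hN (A j) ht
    have h2 := Finset.sum_le_card_nsmul (Finset.univ : Finset ι) _ _
      fun j _ => iidProb_lt_sqrt_sub hp hsum hN (A j) ht
    simp only [nsmul_eq_mul, Finset.card_univ] at h1 h2
    simp only [Sum.elim_inl, Sum.elim_inr]
    linarith
  · intro s hs
    refine h s fun j => ?_
    have h1 := hs (Sum.inl j)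
    have h2 := hs (Sum.inr j)
    simp only [Sum.elim_inl, Sum.elim_inr, not_lt] at h1 h2
    rw [abs_le]
    constructor <;> linarith

lemma le_margFst {α β : Type*} [Fintype β] {p : α × β → ℝ} (hp : ∀ w, 0 ≤ p w) (x : α) (y : β) :
    p (x, y) ≤ margFst p x :=
  Finset.single_le_sum (f := fun y => p (x, y)) (fun _ _ => hp _) (Finset.mem_univ y)

lemma le_margSnd {α β : Type*} [Fintype α] {p : α × β → ℝ} (hp : ∀ w, 0 ≤ p w) (x : α) (y : β) :
    p (x, y) ≤ margSnd p y :=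
  Finset.single_le_sum (f := fun x => p (x, y)) (fun _ _ => hp _) (Finset.mem_univ x)

lemma eventMass_le_sum {α : Type*} [Fintype α] {p : α → ℝ} (hp : ∀ a, 0 ≤ p a)
    (A : α → Prop) : eventMass p A ≤ ∑ a, p a :=
  Finset.sum_le_sum fun a _ => by split_ifs <;> simp [hp]

lemma mutInfo_le_of_sqrt_close {α β : Type*} [Fintype α] [Fintype β] {p p' : α × β → ℝ}
    (hp : ∀ w, 0 ≤ p w) (hsum : ∑ w, p w = 1) (hp' : ∀ w, 0 ≤ p' w) (hsum' : ∑ w, p' w = 1)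
    {t n : ℝ} (ht : 0 ≤ t) (dp : ∀ w, |√(p' w) - √(p w)| ≤ t)
    (da : ∀ x, |√(margFst p' x) - √(margFst p x)| ≤ t)
    (db : ∀ y, |√(margSnd p' y) - √(margSnd p y)| ≤ t)
    (hn : 0 < n) (hnt : 1 ≤ n * t ^ 2) (hlog : 1 / 2 ≤ Real.log n) :
    mutInfo p ≤ 50 * mutInfo p' +
      Fintype.card α * Fintype.card β * (90000 * (t ^ 2 * Real.log n)) := by
  rw [mutInfo_eq_sum_relEntropyTerm p hsum, mutInfo_eq_sum_relEntropyTerm p' hsum']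
  have h1 : ∀ (p : α × β → ℝ), (∀ w, 0 ≤ p w) → ∑ w, p w = 1 → ∀ x, margFst p x ≤ 1 :=
    fun p hp hs x => by
      rw [← eventMass_fst, ← hs]; exact eventMass_le_sum hp _
  have h2 : ∀ y, margSnd p y ≤ 1 := fun y => by
    rw [← eventMass_snd, ← hsum]; exact eventMass_le_sum hp _
  have := Finset.sum_le_sum fun x (_ : x ∈ (Finset.univ : Finset α)) =>
    Finset.sum_le_sum fun y (_ : y ∈ (Finset.univ : Finset β)) =>
      relEntropyTerm_le_relEntropyTerm_of_close (hp (x, y)) (le_margFst hp x y) (h1 p hp hsum x)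
        (le_margSnd hp x y) (h2 y) (hp' (x, y)) (le_margFst hp' x y) (h1 p' hp' hsum' x)
        (le_margSnd hp' x y) ht (dp _) (da _) (db _) hn hnt hlog
  refine this.trans (le_of_eq ?_)
  simp only [Finset.sum_add_distrib, ← Finset.mul_sum, Finset.sum_const, Finset.card_univ,
    nsmul_eq_mul]
  ring

/-- With probability at least `1 - δ`, the empirical mutual information satisfies
`Î(X;Y) ≥ (1/50)·I(X;Y) − 1800·|Σ|²·(log N / N)·log(6|Σ|²/δ)`. -/
theorem empirical_mi_lower_bound (S : Type) [Fintype S] (hS : 2 ≤ Fintype.card S)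
    (p : S × S → ℝ) (hp : ∀ w, 0 ≤ p w) (hsum : (∑ w, p w) = 1)
    (N : ℕ) (hN : 1 < N) (δ : ℝ) (hδ0 : 0 < δ) (hδ1 : δ < 1) :
    1 - δ ≤ iidProb p N (fun s =>
      (1 / 50) * mutInfo p -
          1800 * (Fintype.card S : ℝ) ^ 2 * (Real.log N / N) *
            Real.log (6 * (Fintype.card S : ℝ) ^ 2 / δ) ≤
        mutInfo (empFreq s)) := by
  set k : ℝ := (Fintype.card S : ℝ) with hk
  have hk2 : 2 ≤ k := by rw [hk]; exact_mod_cast hS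
  have hN0 : N ≠ 0 := by omega
  have hNpos : (0 : ℝ) < N := by positivity
  have hlogN : 1 / 2 ≤ Real.log N := by
    have h1 : Real.log 2 ≤ Real.log N :=
      Real.log_le_log (by norm_num) (by exact_mod_cast hN)
    linarith [Real.log_two_gt_d9]
  set L := Real.log (6 * k ^ 2 / δ) with hL
  have hL1 : 1 ≤ L := by
    rw [hL, Real.le_log_iff_exp_le (by positivity), le_div_iff₀ hδ0]
    nlinarith [Real.exp_one_lt_d9, Real.exp_pos 1]
  have ht2 : √(L / N) ^ 2 = L / N := Real.sq_sqrt (by positivity)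
  have hNL : (N : ℝ) * (L / N) = L := by field_simp
  let A : (S × S) ⊕ (S ⊕ S) → S × S → Prop :=
    Sum.elim (fun a w => w = a) (Sum.elim (fun x w => w.1 = x) (fun y w => w.2 = y))
  refine le_trans ?_ (iidProb_forall_sqrt_close hp hsum hN0 A (Real.sqrt_nonneg (L / N)) _ ?_)
  · rw [ht2, hNL, Real.exp_neg, hL, Real.exp_log (by positivity)]
    simp only [Fintype.card_sum, Fintype.card_prod]
    push_cast
    rw [← hk, inv_div]
    have : 2 * (k * k + (k + k)) * (δ / (6 * k ^ 2)) ≤ δ := by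
      rw [mul_div_assoc', div_le_iff₀ (by positivity)]
      nlinarith [mul_nonneg hδ0.le (show 0 ≤ k * (k - 1) by nlinarith)]
    linarith
  · intro s hs
    have h := mutInfo_le_of_sqrt_close hp hsum (empFreq_nonneg s)
      (sum_empFreq hN0 s) (Real.sqrt_nonneg (L / N))
      (fun w => by simpa only [A, Sum.elim_inl, eventMass_eq] using hs (.inl w))
      (fun x => by
        simpa only [A, Sum.elim_inl, Sum.elim_inr, eventMass_fst] using hs (.inr (.inl x)))
      (fun y => by
        simpa only [A, Sum.elim_inl, Sum.elim_inr, eventMass_snd] using hs (.inr (.inr y)))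
      hNpos (by rw [ht2, hNL]; exact hL1) hlogN
    rw [ht2, ← hk] at h
    have e : k * k * (90000 * (L / N * Real.log N)) =
        50 * (1800 * k ^ 2 * (Real.log N / N) * L) := by ring
    rw [e] at h
    linarith
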